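/- For every H in (1/2, 1), the oscillatory fractional Brownian motion covariance kernel R_H is positive semidefinite on [0,∞): for every n ≥ 1, all t₁, …, t_n ≥ 0 and all real c₁, …, c_n, Σ_{i=1}^n Σ_{k=1}^n c_i c_k R_H(t_i, t_k) ≥ 0. (Hence a centered Gaussian process ξ^H with covariance R_H, the ofBm, exists.) -/

import Mathlib

open Real

/-- The oscillatory function `h_t = Σ_{j∈ℤ} (b a^j t)^{-2H} (e^{-b a^j t} - 1 + b a^j t)`. -/
noncomputable def hosc (a b H t : ℝ) : ℝ :=
  ∑' j : ℤ, (b * a ^ j * t) ^ (-(2 * H)) *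
    (Real.exp (-(b * a ^ j * t)) - 1 + b * a ^ j * t)

/-- The oscillatory fractional Brownian motion covariance `R_H(s,t)`. -/
noncomputable def Rcov (a b H s t : ℝ) : ℝ :=
  (1 / 2) * (s ^ (2 * H) * hosc a b H s + t ^ (2 * H) * hosc a b H t
    - |s - t| ^ (2 * H) * hosc a b H |s - t|)

lemma phi_nonneg (x : ℝ) : 0 ≤ Real.exp (-x) - 1 + x := by
  have := Real.add_one_le_exp (-x)
  linarith

lemma phi_le_self {x : ℝ} (hx : 0 ≤ x) : Real.exp (-x) - 1 + x ≤ x := by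
  have : Real.exp (-x) ≤ 1 := Real.exp_le_one_iff.mpr (by linarith)
  linarith

lemma phi_le_sq {x : ℝ} (hx : 0 ≤ x) : Real.exp (-x) - 1 + x ≤ x ^ 2 := by
  have h1 := Real.add_one_le_exp x
  have h2 : Real.exp (-x) * Real.exp x = 1 := by rw [← Real.exp_add]; simp
  have h3 : Real.exp (-x) * (x + 1) ≤ 1 := by
    exact (mul_le_mul_of_nonneg_left h1 (Real.exp_pos _).le).trans h2.le
  have h4 : 0 ≤ x ^ 3 := by positivity
  have h5 : (Real.exp (-x)) * (x + 1) ≤ (1 - x + x ^ 2) * (x + 1) := by nlinarith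
  have := le_of_mul_le_mul_right h5 (by linarith)
  linarith

lemma summ_aux (a b : ℝ) (ha0 : 0 < a) (ha1 : a < 1) (hb : 0 < b)
    (H : ℝ) (hH1 : 1 / 2 < H) (hH2 : H < 1) (t : ℝ) (ht : 0 ≤ t) :
    Summable (fun j : ℤ => (b * a ^ j) ^ (-(2 * H)) *
      (Real.exp (-(b * a ^ j * t)) - 1 + b * a ^ j * t)) := by
  apply Summable.of_nat_of_neg
  · have hg : Summable (fun n : ℕ => t ^ 2 * b ^ (2 - 2 * H) * (a ^ (2 - 2 * H)) ^ n) := by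
      apply Summable.mul_left
      apply summable_geometric_of_lt_one (by positivity)
      exact Real.rpow_lt_one ha0.le ha1 (by linarith)
    refine Summable.of_nonneg_of_le (fun n => ?_) (fun n => ?_) hg
    · exact mul_nonneg (by positivity) (phi_nonneg _)
    · have hl : 0 < b * a ^ (n : ℤ) := by positivity
      calc _ ≤ (b * a ^ (n : ℤ)) ^ (-(2 * H)) * (b * a ^ (n : ℤ) * t) ^ 2 :=
            mul_le_mul_of_nonneg_left (phi_le_sq (by positivity)) (by positivity)
        _ = t ^ 2 * (b * a ^ (n : ℤ)) ^ (2 - 2 * H) := by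
            rw [show 2 - 2 * H = -(2 * H) + 2 by ring, Real.rpow_add hl, Real.rpow_two]; ring
        _ = _ := by
            rw [Real.mul_rpow hb.le (by positivity), zpow_natCast, ← Real.rpow_natCast a n,
              ← Real.rpow_natCast (a ^ (2 - 2 * H)) n, ← Real.rpow_mul ha0.le,
              ← Real.rpow_mul ha0.le, mul_comm (n : ℝ), mul_assoc]
  · have hg : Summable (fun n : ℕ => t * b ^ (1 - 2 * H) * (a ^ (2 * H - 1)) ^ n) := by
      apply Summable.mul_left
      apply summable_geometric_of_lt_one (by positivity)
      exact Real.rpow_lt_one ha0.le ha1 (by linarith)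
    refine Summable.of_nonneg_of_le (fun n => ?_) (fun n => ?_) hg
    · exact mul_nonneg (by positivity) (phi_nonneg _)
    · have hl : 0 < b * a ^ (-(n : ℤ)) := by positivity
      calc _ ≤ (b * a ^ (-(n : ℤ))) ^ (-(2 * H)) * (b * a ^ (-(n : ℤ)) * t) :=
            mul_le_mul_of_nonneg_left (phi_le_self (by positivity)) (by positivity)
        _ = t * (b * a ^ (-(n : ℤ))) ^ (1 - 2 * H) := by
            rw [show 1 - 2 * H = -(2 * H) + 1 by ring, Real.rpow_add hl, Real.rpow_one]; ring
        _ = _ := by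
            rw [Real.mul_rpow hb.le (by positivity), ← Real.rpow_intCast,
              ← Real.rpow_natCast, ← Real.rpow_mul ha0.le, ← Real.rpow_mul ha0.le, mul_assoc]
            congr 3
            push_cast; ring

lemma hasSum_aux (a b : ℝ) (ha0 : 0 < a) (ha1 : a < 1) (hb : 0 < b)
    (H : ℝ) (hH1 : 1 / 2 < H) (hH2 : H < 1) (t : ℝ) (ht : 0 ≤ t) :
    HasSum (fun j : ℤ => (b * a ^ j) ^ (-(2 * H)) *
      (Real.exp (-(b * a ^ j * t)) - 1 + b * a ^ j * t)) (t ^ (2 * H) * hosc a b H t) := by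
  have hs := (summ_aux a b ha0 ha1 hb H hH1 hH2 t ht).hasSum
  convert hs using 1
  rw [hosc, ← tsum_mul_left]
  refine tsum_congr fun j => ?_
  rcases ht.eq_or_lt with rfl | ht
  · simp
  · rw [Real.mul_rpow (by positivity) ht.le, Real.rpow_neg ht.le (2 * H)]
    have : t ^ (2 * H) ≠ 0 := by positivity
    field_simp

lemma integ_aux {s t T : ℝ} (hs : 0 ≤ s) (hst : s ≤ t) (htT : t ≤ T) :
    ∫ w in (0:ℝ)..T, (1 - Real.exp (-(max (s - w) 0))) * (1 - Real.exp (-(max (t - w) 0)))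
      = s - (1 - Real.exp (-s)) - (Real.exp (-(t - s)) - Real.exp (-t))
        + (1 / 2) * (Real.exp (-(t - s)) - Real.exp (-(t + s))) := by
  have hc : Continuous (fun w : ℝ =>
      (1 - Real.exp (-(max (s - w) 0))) * (1 - Real.exp (-(max (t - w) 0)))) := by fun_prop
  rw [← intervalIntegral.integral_add_adjacent_intervals (b := s)
    (hc.intervalIntegrable _ _) (hc.intervalIntegrable _ _)]
  have h2 : ∫ w in s..T, (1 - Real.exp (-(max (s - w) 0))) * (1 - Real.exp (-(max (t - w) 0)))
      = 0 := by
    rw [intervalIntegral.integral_congr (g := fun _ => (0:ℝ))]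
    · simp
    · intro w hw
      rw [Set.uIcc_of_le (by linarith)] at hw
      have : max (s - w) 0 = 0 := max_eq_right (by linarith [hw.1])
      simp [this]
  have h1 : ∫ w in (0:ℝ)..s,
      (1 - Real.exp (-(max (s - w) 0))) * (1 - Real.exp (-(max (t - w) 0)))
      = ∫ w in (0:ℝ)..s, (1 - Real.exp (w - s) - Real.exp (w - t) + Real.exp (2 * w - s - t)) := by
    apply intervalIntegral.integral_congr
    intro w hw
    rw [Set.uIcc_of_le hs] at hw
    have e1 : max (s - w) 0 = s - w := max_eq_left (by linarith [hw.2])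
    have e2 : max (t - w) 0 = t - w := max_eq_left (by linarith [hw.2])
    simp only [e1, e2]
    rw [show 2 * w - s - t = (w - s) + (w - t) by ring, Real.exp_add, neg_sub, neg_sub]
    ring
  have h3 : ∫ w in (0:ℝ)..s,
      (1 - Real.exp (w - s) - Real.exp (w - t) + Real.exp (2 * w - s - t))
      = (s - Real.exp (s - s) - Real.exp (s - t) + Real.exp (2 * s - s - t) / 2)
       - (0 - Real.exp (0 - s) - Real.exp (0 - t) + Real.exp (2 * 0 - s - t) / 2) := by
    apply intervalIntegral.integral_eq_sub_of_hasDerivAt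
      (f := fun w => w - Real.exp (w - s) - Real.exp (w - t) + Real.exp (2 * w - s - t) / 2)
    · intro w _
      have d1 := ((hasDerivAt_id w).sub_const s).exp
      have d2 := ((hasDerivAt_id w).sub_const t).exp
      have d3 := (((((hasDerivAt_id w).const_mul 2).sub_const s).sub_const t).exp).div_const 2
      have := (((hasDerivAt_id w).sub d1).sub d2).add d3
      refine this.congr_deriv ?_
      simp only [id]
      ring
    · apply Continuous.intervalIntegrable
      fun_prop
  rw [h2, h1, h3]
  rw [show 2 * s - s - t = -(t - s) by ring, show s - t = -(t - s) by ring,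
    show 2 * 0 - s - t = -(t + s) by ring, sub_self, zero_sub, zero_sub, Real.exp_zero]
  ring

lemma kernel_le {s t T : ℝ} (hs : 0 ≤ s) (hst : s ≤ t) (htT : t ≤ T) :
    (1 / 2) * ((Real.exp (-s) - 1 + s) + (Real.exp (-t) - 1 + t)
      - (Real.exp (-|s - t|) - 1 + |s - t|))
    = (1 / 2) * ((1 - Real.exp (-s)) * (1 - Real.exp (-t))) +
      ∫ w in (0:ℝ)..T,
        (1 - Real.exp (-(max (s - w) 0))) * (1 - Real.exp (-(max (t - w) 0))) := by
  rw [integ_aux hs hst htT, abs_of_nonpos (by linarith : s - t ≤ 0), neg_sub,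
    show -(t + s) = -t + -s by ring, Real.exp_add]
  ring

lemma kernel_eq {s t T : ℝ} (hs : 0 ≤ s) (ht : 0 ≤ t) (hsT : s ≤ T) (htT : t ≤ T) :
    (1 / 2) * ((Real.exp (-s) - 1 + s) + (Real.exp (-t) - 1 + t)
      - (Real.exp (-|s - t|) - 1 + |s - t|))
    = (1 / 2) * ((1 - Real.exp (-s)) * (1 - Real.exp (-t))) +
      ∫ w in (0:ℝ)..T,
        (1 - Real.exp (-(max (s - w) 0))) * (1 - Real.exp (-(max (t - w) 0))) := by
  rcases le_total s t with h | h
  · exact kernel_le hs h htT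
  · have := kernel_le (T := T) ht h hsT
    rw [abs_sub_comm t s] at this
    simp_rw [mul_comm (1 - Real.exp (-(max (s - _) 0)))]
    linarith

lemma kernel_psd {n : ℕ} (s c : Fin n → ℝ) (hs : ∀ i, 0 ≤ s i) :
    0 ≤ ∑ i, ∑ k, c i * c k * ((1 / 2) * ((Real.exp (-s i) - 1 + s i)
      + (Real.exp (-s k) - 1 + s k) - (Real.exp (-|s i - s k|) - 1 + |s i - s k|))) := by
  set T := ∑ i, s i with hT
  have hle : ∀ i, s i ≤ T := fun i =>
    Finset.single_le_sum (fun j _ => hs j) (Finset.mem_univ i)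
  have hT0 : 0 ≤ T := Finset.sum_nonneg fun i _ => hs i
  have key : ∑ i, ∑ k, c i * c k * ((1 / 2) * ((Real.exp (-s i) - 1 + s i)
      + (Real.exp (-s k) - 1 + s k) - (Real.exp (-|s i - s k|) - 1 + |s i - s k|)))
      = (1 / 2) * (∑ i, c i * (1 - Real.exp (-s i))) ^ 2 +
        ∫ w in (0:ℝ)..T, (∑ i, c i * (1 - Real.exp (-(max (s i - w) 0)))) ^ 2 := by
    have hI : ∫ w in (0:ℝ)..T, (∑ i, c i * (1 - Real.exp (-(max (s i - w) 0)))) ^ 2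
        = ∑ i, ∑ k, c i * c k * ∫ w in (0:ℝ)..T,
        (1 - Real.exp (-(max (s i - w) 0))) * (1 - Real.exp (-(max (s k - w) 0))) := by
      simp_rw [sq, Finset.sum_mul_sum]
      rw [intervalIntegral.integral_finsetSum]
      · refine Finset.sum_congr rfl fun i _ => ?_
        rw [intervalIntegral.integral_finsetSum]
        · refine Finset.sum_congr rfl fun k _ => ?_
          rw [← intervalIntegral.integral_const_mul]
          congr 1; ext w; ring
        · intro k _
          apply Continuous.intervalIntegrable
          fun_prop
      · intro k _
        apply Continuous.intervalIntegrable
        fun_prop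
    rw [hI, sq, Finset.sum_mul_sum, Finset.mul_sum, ← Finset.sum_add_distrib]
    refine Finset.sum_congr rfl fun i _ => ?_
    rw [Finset.mul_sum, ← Finset.sum_add_distrib]
    refine Finset.sum_congr rfl fun k _ => ?_
    rw [kernel_eq (hs i) (hs k) (hle i) (hle k)]
    ring
  rw [key]
  have := intervalIntegral.integral_nonneg (μ := MeasureTheory.volume) hT0
    (fun w _ => sq_nonneg (∑ i, c i * (1 - Real.exp (-(max (s i - w) 0)))))
  positivity

theorem stmt8 (a b : ℝ) (ha0 : 0 < a) (ha1 : a < 1) (hb : 0 < b)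
    (H : ℝ) (hH1 : 1 / 2 < H) (hH2 : H < 1) :
    ∀ (n : ℕ), 1 ≤ n → ∀ (t c : Fin n → ℝ), (∀ i, 0 ≤ t i) →
      0 ≤ ∑ i, ∑ k, c i * c k * Rcov a b H (t i) (t k) := by
  intro n _ t c ht
  have hS := hasSum_aux a b ha0 ha1 hb H hH1 hH2
  have hsum := hasSum_sum (s := Finset.univ) fun i (_ : i ∈ Finset.univ) =>
    hasSum_sum (s := Finset.univ) fun k (_ : k ∈ Finset.univ) =>
      ((((hS (t i) (ht i)).add (hS (t k) (ht k))).sub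
        (hS |t i - t k| (abs_nonneg _))).mul_left (1 / 2)).mul_left (c i * c k)
  refine hsum.nonneg fun j => ?_
  have hl : 0 < b * a ^ j := by positivity
  have hp := kernel_psd (fun i => b * a ^ j * t i) c (fun i => mul_nonneg hl.le (ht i))
  have := mul_nonneg (Real.rpow_nonneg hl.le (-(2 * H))) hp
  convert this using 1
  rw [Finset.mul_sum]
  refine Finset.sum_congr rfl fun i _ => ?_
  rw [Finset.mul_sum]
  refine Finset.sum_congr rfl fun k _ => ?_
  rw [← mul_sub, abs_mul, abs_of_pos hl]
  ring
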